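/- Let D ⊆ F_q^* and let C_D = {(Tr(βx))_{x∈D} : β ∈ F_q}, and assume C_D has dimension m over F_p. Then C_D is a minimal code if and only if for every pair of F_p-linearly independent elements β_1, β_2 ∈ F_q one has Σ_{y∈F_p^*} ( Σ_{c∈F_p^*} f̂_D(yβ_1 + yc·β_2) + f̂_D(yβ_2) − (p−1)·f̂_D(yβ_1) ) ≠ (ζ_p − 1)(p−1)|D|, where f_D is the characteristic function of D. -/

import Mathlib

open Finset

open ZMod in
lemma exp_zpow_val_sub_val {p : ℕ} [NeZero p] (a b : ZMod p) :
    Complex.exp (2 * Real.pi * Complex.I / p) ^ ((a.val : ℤ) - (b.val : ℤ)) =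
      stdAddChar (a - b) := by
  rw [← Complex.exp_int_mul]
  have h : a - b = (((a.val : ℤ) - (b.val : ℤ) : ℤ) : ZMod p) := by simp
  rw [h, stdAddChar_coe]
  congr 1
  ring

lemma sum_ne_zero_stdAddChar_neg_mul {p : ℕ} [Fact p.Prime] (t : ZMod p) :
    ∑ y ∈ univ \ {(0 : ZMod p)}, ZMod.stdAddChar (-(y * t)) =
      (if t = 0 then (p : ℂ) else 0) - 1 := by
  have h := AddChar.sum_mulShift (-t) (ZMod.isPrimitive_stdAddChar p)
  rw [← sum_sdiff (subset_univ {(0 : ZMod p)})] at h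
  simp only [mul_neg, neg_eq_zero, sum_singleton, zero_mul, neg_zero, AddChar.map_zero_eq_one,
    ZMod.card] at h
  rw [eq_sub_iff_add_eq, h]
  split_ifs <;> simp

lemma sum_ne_zero_ite_add_mul_eq_zero {K : Type*} [Field K] [Fintype K] [DecidableEq K]
    (a b : K) (r : ℂ) :
    ∑ c ∈ univ \ {(0 : K)}, (if a + c * b = 0 then r else 0) =
      if b = 0 then (if a = 0 then ((Fintype.card K : ℂ) - 1) * r else 0)
      else if a = 0 then 0 else r := by
  by_cases hb : b = 0
  · subst hb
    by_cases ha : a = 0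
    · simp [ha, card_sdiff, Nat.cast_sub (Fintype.card_pos (α := K))]
    · simp [ha]
  · have h (c : K) : a + c * b = 0 ↔ c = -a / b := by
      rw [eq_div_iff hb]
      constructor <;> intro h <;> linear_combination h
    simp_rw [h, sum_ite_eq', if_neg hb]
    by_cases ha : a = 0 <;> simp [ha, hb]

lemma sum_stdAddChar_pencil {p : ℕ} [Fact p.Prime] (a b : ZMod p) :
    ∑ y ∈ univ \ {(0 : ZMod p)},
      ((∑ c ∈ univ \ {(0 : ZMod p)}, ZMod.stdAddChar (-(y * (a + c * b)))) +
        ZMod.stdAddChar (-(y * b)) - ((p : ℂ) - 1) * ZMod.stdAddChar (-(y * a))) =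
      ((p : ℂ) - 1) - if a = 0 ∧ b ≠ 0 then (p : ℂ) ^ 2 else 0 := by
  rw [sum_sub_distrib, sum_add_distrib, sum_comm, ← mul_sum]
  simp_rw [sum_ne_zero_stdAddChar_neg_mul, sum_sub_distrib, sum_ne_zero_ite_add_mul_eq_zero]
  have h1 : ((p - 1 : ℕ) : ℂ) = (p : ℂ) - 1 :=
    Nat.cast_pred (Fact.out : p.Prime).pos
  by_cases ha : a = 0 <;> by_cases hb : b = 0 <;>
    simp [ha, hb, card_sdiff, ZMod.card, h1] <;> ring

lemma exists_trace_mul_ne_zero (K : Type*) {L : Type*} [Field K] [Field L] [Algebra K L]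
    [FiniteDimensional K L] [Algebra.IsSeparable K L] {w : L} (hw : w ≠ 0) :
    ∃ x, Algebra.trace K L (w * x) ≠ 0 := by
  by_contra! h
  exact hw ((traceForm_nondegenerate K L).1 w h)

lemma sum_stdAddChar_neg_trace_mul {p : ℕ} [Fact p.Prime] {F : Type*} [Field F] [Fintype F]
    [Algebra (ZMod p) F] {w : F} (hw : w ≠ 0) :
    ∑ x : F, ZMod.stdAddChar (-Algebra.trace (ZMod p) F (w * x)) = (0 : ℂ) := by
  obtain ⟨z, hz⟩ := exists_trace_mul_ne_zero (ZMod p) hw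
  let φ : F →+ ZMod p :=
    -((Algebra.trace (ZMod p) F).toAddMonoidHom.comp (AddMonoidHom.mulLeft w))
  refine AddChar.sum_eq_zero_iff_ne_zero.2
    (show (ZMod.stdAddChar (N := p)).compAddMonoidHom φ ≠ 0 from fun h => hz ?_)
  have h1 := DFunLike.congr_fun h z
  have h2 : ZMod.stdAddChar (-Algebra.trace (ZMod p) F (w * z)) = ZMod.stdAddChar (0 : ZMod p) := by
    rw [AddChar.map_zero_eq_one]
    exact h1
  exact neg_eq_zero.1 (ZMod.injective_stdAddChar h2)

/-- The Walsh transform of an indicator function away from the origin. -/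
lemma sum_stdAddChar_indicator_sub_trace {p : ℕ} [Fact p.Prime] {F : Type*} [Field F] [Fintype F]
    [DecidableEq F] [Algebra (ZMod p) F] (D : Finset F) {w : F} (hw : w ≠ 0) :
    ∑ x : F, ZMod.stdAddChar ((if x ∈ D then 1 else 0) - Algebra.trace (ZMod p) F (w * x)) =
      ((ZMod.stdAddChar (1 : ZMod p) : ℂ) - 1) *
        ∑ x ∈ D, ZMod.stdAddChar (-Algebra.trace (ZMod p) F (w * x)) := by
  have h (x : F) :
      (ZMod.stdAddChar ((if x ∈ D then 1 else 0) - Algebra.trace (ZMod p) F (w * x)) : ℂ) =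
        ZMod.stdAddChar (-Algebra.trace (ZMod p) F (w * x)) +
        if x ∈ D then ((ZMod.stdAddChar (1 : ZMod p) : ℂ) - 1) *
          ZMod.stdAddChar (-Algebra.trace (ZMod p) F (w * x)) else 0 := by
    split_ifs
    · rw [sub_eq_add_neg, AddChar.map_add_eq_mul]
      ring
    · simp
  simp_rw [h, sum_add_distrib, sum_stdAddChar_neg_trace_mul hw, zero_add, sum_ite_mem, univ_inter,
    mul_sum]

/-- The `F_p`-linear encoder `β ↦ (Tr(βx))_{x ∈ D}`. -/
noncomputable def traceEncoder (K : Type*) {L : Type*} [Field K] [Field L] [Algebra K L]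
    (D : Finset L) : L →ₗ[K] (D → K) :=
  LinearMap.pi fun x => Algebra.trace K L ∘ₗ LinearMap.mulRight K (x : L)

lemma walsh_pencil_sum_eq_iff {p : ℕ} [Fact p.Prime] {F : Type*} [Field F] [Fintype F]
    [DecidableEq F] [Algebra (ZMod p) F] (D : Finset F) (W : F → ℂ)
    (hW : ∀ w ≠ 0, W w = ((ZMod.stdAddChar (1 : ZMod p) : ℂ) - 1) *
      ∑ x ∈ D, ZMod.stdAddChar (-Algebra.trace (ZMod p) F (w * x)))
    {β₁ β₂ : F} (hβ : LinearIndependent (ZMod p) ![β₁, β₂]) :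
    (∑ y ∈ univ \ {(0 : ZMod p)},
      ((∑ c ∈ univ \ {(0 : ZMod p)}, W (y • β₁ + (y * c) • β₂)) +
        W (y • β₂) - ((p : ℂ) - 1) * W (y • β₁))) =
        ((ZMod.stdAddChar (1 : ZMod p) : ℂ) - 1) * ((p : ℂ) - 1) * D.card ↔
      ∀ x ∈ D, Algebra.trace (ZMod p) F (β₂ * x) ≠ 0 → Algebra.trace (ZMod p) F (β₁ * x) ≠ 0 := by
  rw [LinearIndependent.pair_iff] at hβ
  have hp : (p : ℂ) ≠ 0 := Nat.cast_ne_zero.2 (Fact.out : p.Prime).ne_zero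
  have hζ : (ZMod.stdAddChar (1 : ZMod p) : ℂ) - 1 ≠ 0 := by
    rw [sub_ne_zero, ← AddChar.map_zero_eq_one (ZMod.stdAddChar (N := p))]
    exact ZMod.injective_stdAddChar.ne one_ne_zero
  set T : F →ₗ[ZMod p] ZMod p := Algebra.trace (ZMod p) F with hT
  have key : (∑ y ∈ univ \ {(0 : ZMod p)},
      ((∑ c ∈ univ \ {(0 : ZMod p)}, W (y • β₁ + (y * c) • β₂)) +
        W (y • β₂) - ((p : ℂ) - 1) * W (y • β₁))) =
      ((ZMod.stdAddChar (1 : ZMod p) : ℂ) - 1) *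
        ∑ x ∈ D, (((p : ℂ) - 1) - if T (β₁ * x) = 0 ∧ T (β₂ * x) ≠ 0 then (p : ℂ) ^ 2 else 0) := by
    simp_rw [← sum_stdAddChar_pencil]
    rw [sum_comm, mul_sum]
    refine sum_congr rfl fun y hy => ?_
    have hy0 : y ≠ 0 := by simpa using hy
    have e1 (c : ZMod p) : W (y • β₁ + (y * c) • β₂) =
        ((ZMod.stdAddChar (1 : ZMod p) : ℂ) - 1) *
          ∑ x ∈ D, ZMod.stdAddChar (-(y * (T (β₁ * x) + c * T (β₂ * x)))) := by
      rw [hW _ fun h => hy0 (hβ _ _ h).1]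
      simp [hT, add_mul, mul_add, mul_assoc]
    have e2 : W (y • β₂) = ((ZMod.stdAddChar (1 : ZMod p) : ℂ) - 1) *
          ∑ x ∈ D, ZMod.stdAddChar (-(y * T (β₂ * x))) := by
      rw [hW _ fun h => hy0 (hβ 0 y (by simpa using h)).2]
      simp [hT]
    have e3 : W (y • β₁) = ((ZMod.stdAddChar (1 : ZMod p) : ℂ) - 1) *
          ∑ x ∈ D, ZMod.stdAddChar (-(y * T (β₁ * x))) := by
      rw [hW _ fun h => hy0 (hβ y 0 (by simpa using h)).1]
      simp [hT]
    simp_rw [e1, e2, e3]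
    rw [sum_sub_distrib, sum_add_distrib, sum_comm, ← mul_sum, ← mul_sum]
    rw [sum_comm]
    ring
  rw [key, mul_assoc, mul_right_inj' hζ, sum_sub_distrib, sum_const, nsmul_eq_mul,
    mul_comm (D.card : ℂ), sub_eq_self, ← sum_filter, sum_const, nsmul_eq_mul, mul_eq_zero,
    or_iff_left (pow_ne_zero 2 hp), Nat.cast_eq_zero, card_eq_zero, filter_eq_empty_iff]
  refine forall₂_congr fun x _ => ?_
  tauto

/-- Let `D ⊆ F_q^*` and `C_D = {(Tr(βx))_{x ∈ D} : β ∈ F_q}` of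
dimension `m` over `F_p`. Then `C_D` is minimal if and only if for every pair of
`F_p`-linearly independent `β_1, β_2 ∈ F_q`,
`Σ_{y ∈ F_p^*} (Σ_{c ∈ F_p^*} f̂_D(yβ_1 + yc·β_2) + f̂_D(yβ_2) − (p−1)·f̂_D(yβ_1))
  ≠ (ζ_p − 1)(p−1)|D|`. -/
theorem defining_set_code_minimal_iff
    {p m : ℕ} [Fact p.Prime] (hm : 0 < m)
    (F : Type) [Field F] [Fintype F] [DecidableEq F]
    [Algebra (ZMod p) F] (hF : Fintype.card F = p ^ m)
    (D : Finset F) (hD : (0 : F) ∉ D) :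
    -- the primitive `p`-th root of unity `ζ_p = exp(2πi/p)`
    let ζ : ℂ := Complex.exp (2 * Real.pi * Complex.I / p)
    -- the absolute trace
    let Tr : F → ZMod p := fun x => Algebra.trace (ZMod p) F x
    -- the characteristic function of `D`
    let fD : F → ZMod p := fun x => if x ∈ D then 1 else 0
    -- the Walsh transform of `f_D`
    let W : F → ℂ := fun w => ∑ x : F, ζ ^ (((fD x).val : ℤ) - ((Tr (w * x)).val : ℤ))
    -- the codewords of `C_D`, indexed by `x ∈ D`
    let cw : F → (D → ZMod p) := fun β x => Tr (β * x)
    let CD : Set (D → ZMod p) := Set.range cw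
    -- `C_D` has dimension `m`
    (Module.finrank (ZMod p) (Submodule.span (ZMod p) CD) = m) →
    -- `C_D` is minimal iff the Walsh-transform condition holds
    ((∀ a ∈ CD, a ≠ 0 → ∀ b ∈ CD, (∀ i, b i ≠ 0 → a i ≠ 0) → ∃ k : ZMod p, b = k • a) ↔
      (∀ β₁ β₂ : F, LinearIndependent (ZMod p) ![β₁, β₂] →
        (∑ y ∈ Finset.univ \ {(0 : ZMod p)},
          ((∑ c ∈ Finset.univ \ {(0 : ZMod p)}, W (y • β₁ + (y * c) • β₂)) +
            W (y • β₂) - ((p : ℂ) - 1) * W (y • β₁))) ≠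
          (ζ - 1) * ((p : ℂ) - 1) * D.card)) := by
  intro ζ Tr fD W cw CD hdim
  have hp := (Fact.out : p.Prime)
  have hcw : cw = traceEncoder (ZMod p) D := rfl
  have hfin : Module.finrank (ZMod p) F = m := by
    have h := Module.card_eq_pow_finrank (K := ZMod p) (V := F)
    rw [hF, ZMod.card] at h
    exact (Nat.pow_right_injective hp.two_le h).symm
  have hinj : Function.Injective (traceEncoder (ZMod p) D) := by
    rw [← LinearMap.ker_eq_bot, ← Submodule.finrank_eq_zero]
    have h1 : Submodule.span (ZMod p) CD = LinearMap.range (traceEncoder (ZMod p) D) := by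
      rw [← Submodule.span_eq (LinearMap.range _), LinearMap.coe_range, ← hcw]
    have h2 := (traceEncoder (ZMod p) D).finrank_range_add_finrank_ker
    rw [← h1, hdim, hfin] at h2
    lia
  have hζ : ζ = ZMod.stdAddChar (1 : ZMod p) := by
    have h := exp_zpow_val_sub_val (1 : ZMod p) 0
    have : Fact (1 < p) := ⟨hp.one_lt⟩
    simpa [ZMod.val_one] using h
  have hW : ∀ w ≠ 0, W w = ((ZMod.stdAddChar (1 : ZMod p) : ℂ) - 1) *
      ∑ x ∈ D, ZMod.stdAddChar (-Algebra.trace (ZMod p) F (w * x)) := fun w hw => by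
    rw [← sum_stdAddChar_indicator_sub_trace D hw]
    exact sum_congr rfl fun x _ => exp_zpow_val_sub_val _ _
  have hiff (β₁ β₂ : F) (h : LinearIndependent (ZMod p) ![β₁, β₂]) :=
    walsh_pencil_sum_eq_iff D W hW h
  rw [hζ]
  constructor
  · intro hmin β₁ β₂ hβ heq
    rw [hiff β₁ β₂ hβ] at heq
    have hβ' := LinearIndependent.pair_iff.1 hβ
    have hβ₁ : cw β₁ ≠ 0 := fun h => by
      have h0 : β₁ = 0 := hinj (h.trans (map_zero (traceEncoder (ZMod p) D)).symm)
      exact one_ne_zero (hβ' 1 0 (by simp [h0])).1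
    obtain ⟨k, hk⟩ := hmin _ ⟨β₁, rfl⟩ hβ₁ _ ⟨β₂, rfl⟩ fun i => heq i i.2
    have h0 : β₂ = k • β₁ := hinj (hk.trans (map_smul (traceEncoder (ZMod p) D) k β₁).symm)
    exact one_ne_zero (neg_eq_zero.1 (hβ' k (-1) (by simp [h0])).2)
  · rintro hall _ ⟨β₁, rfl⟩ hβ₁ _ ⟨β₂, rfl⟩ hsub
    by_contra! hk
    have hne : β₁ ≠ 0 := by
      rintro rfl
      exact hβ₁ (map_zero (traceEncoder (ZMod p) D))
    have hβ : LinearIndependent (ZMod p) ![β₁, β₂] :=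
      (LinearIndependent.pair_iff' hne).2 fun k h => hk k (by
        rw [← h]
        exact map_smul (traceEncoder (ZMod p) D) k β₁)
    exact hall β₁ β₂ hβ ((hiff β₁ β₂ hβ).2 fun x hx => hsub ⟨x, hx⟩)
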